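/- arXiv:math/0501154 — 2 statements merged into one kernel-verified Lean document; each statement's English description precedes it below -/
import Mathlib

section
/- Let V be an isometry on H, T a power bounded operator on K, and X a bounded operator from H to K. If sup_n ||∑_{j=0}^{n} T^j X V*^{j+1}|| < ∞, then the equation X = TZ - ZV has a bounded solution Z (obtained via a Banach limit) satisfying Z(I - VV*) = 0. -/
open ContinuousLinearMap

theorem aux_weak {K : Type*} [NormedAddCommGroup K] [InnerProductSpace ℂ K] [CompleteSpace K]
    (U : Ultrafilter ℕ) (x : ℕ → K) (M : ℝ) (hx : ∀ n, ‖x n‖ ≤ M) :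
    ∃ z : K, ‖z‖ ≤ M ∧ ∀ k : K, Filter.Tendsto (fun n => inner ℂ (x n) k) U
      (nhds (inner ℂ z k)) := by
  have hc := WeakDual.isCompact_closedBall (𝕜 := ℂ) (E := K) 0 M
  let f : ℕ → WeakDual ℂ K := fun n => StrongDual.toWeakDual (InnerProductSpace.toDual ℂ K (x n))
  have hf : ∀ n, f n ∈ WeakDual.toStrongDual ⁻¹' Metric.closedBall (0 : StrongDual ℂ K) M := by
    intro n
    show InnerProductSpace.toDual ℂ K (x n) ∈ Metric.closedBall (0 : StrongDual ℂ K) M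
    rw [mem_closedBall_zero_iff, LinearIsometryEquiv.norm_map]
    exact hx n
  obtain ⟨y, hy, hlim⟩ := hc.ultrafilter_le_nhds (U.map f) (by
    rw [Filter.le_principal_iff]
    exact Filter.mem_map.2 (Filter.univ_mem' hf))
  refine ⟨(InnerProductSpace.toDual ℂ K).symm (WeakDual.toStrongDual y), ?_, fun k => ?_⟩
  · rw [LinearIsometryEquiv.norm_map]
    exact mem_closedBall_zero_iff.1 hy
  · rw [InnerProductSpace.toDual_symm_apply]
    have h1 : Filter.Tendsto f U (nhds y) := hlim
    exact ((WeakDual.eval_continuous k).tendsto y).comp h1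

theorem aux_op {K H : Type*}
    [NormedAddCommGroup K] [InnerProductSpace ℂ K] [CompleteSpace K]
    [NormedAddCommGroup H] [InnerProductSpace ℂ H] [CompleteSpace H]
    (U : Ultrafilter ℕ) (A : ℕ → H →L[ℂ] K) (M : ℝ) (hA : ∀ n, ‖A n‖ ≤ M) :
    ∃ Z : H →L[ℂ] K, ∀ h k, Filter.Tendsto (fun n => inner ℂ (A n h) k) U
      (nhds (inner ℂ (Z h) k)) := by
  have := fun h => aux_weak U (fun n => A n h) (M * ‖h‖) (fun n => (A n).le_of_opNorm_le (hA n) h)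
  choose z hz hlim using this
  refine ⟨LinearMap.mkContinuous ⟨⟨z, fun a b => ?_⟩, fun c a => ?_⟩ M hz, hlim⟩
  · refine ext_inner_right ℂ fun k => tendsto_nhds_unique (hlim (a + b) k) ?_
    simpa [inner_add_left] using (hlim a k).add (hlim b k)
  · refine ext_inner_right ℂ fun k => tendsto_nhds_unique (hlim (c • a) k) ?_
    simpa only [map_smul, RingHom.id_apply, inner_smul_left] using
      (hlim a k).const_mul ((starRingEnd ℂ) c)

/-- if `V` is an isometry, `T` is power bounded and the partial sums
`∑_{j=0}^{n} T^j X V*^(j+1)` are uniformly bounded in norm, then the commutator equation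
`X = TZ - ZV` has a bounded solution `Z` with `Z (I - V V*) = 0`. -/
theorem stmt2 {K H : Type*}
    [NormedAddCommGroup K] [InnerProductSpace ℂ K] [CompleteSpace K]
    [NormedAddCommGroup H] [InnerProductSpace ℂ H] [CompleteSpace H]
    (V : H →L[ℂ] H) (hV : adjoint V ∘L V = 1)
    (T : K →L[ℂ] K) (hT : ∃ M : ℝ, ∀ n : ℕ, ‖T ^ n‖ ≤ M)
    (X : H →L[ℂ] K)
    (hX : ∃ M : ℝ, ∀ n : ℕ,
      ‖∑ j ∈ Finset.range (n + 1), (T ^ j) ∘L X ∘L ((adjoint V) ^ (j + 1))‖ ≤ M) :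
    ∃ Z : H →L[ℂ] K, X = T ∘L Z - Z ∘L V ∧ Z ∘L (1 - V ∘L adjoint V) = 0 := by
  obtain ⟨M, hM⟩ := hX
  have hVx : ∀ x, adjoint V (V x) = x := fun x => by
    simpa using congrArg (fun f : H →L[ℂ] H => f x) hV
  obtain ⟨S, hS⟩ : ∃ S : ℕ → H →L[ℂ] K, ∀ n, S n =
    ∑ j ∈ Finset.range (n + 1), (T ^ j) ∘L X ∘L ((adjoint V) ^ (j + 1)) := ⟨_, fun _ => rfl⟩
  simp only [← hS] at hM
  have hS0 : ∀ h, S 0 (V h) = X h := fun h => by simp [hS, hVx]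
  have hS1 : ∀ n h, S (n + 1) (V h) = X h + T (S n h) := fun n h => by
    rw [hS, hS, Finset.sum_range_succ']
    simp only [add_apply, sum_apply, comp_apply, map_sum]
    rw [add_comm]
    congr 1
    · simp [hVx]
    · refine Finset.sum_congr rfl fun j _ => ?_
      rw [pow_succ (adjoint V) (j + 1), pow_succ' T j]
      simp [hVx]
  have hSV : ∀ n h, S n (V (adjoint V h)) = S n h := fun n h => by
    rw [hS]
    simp only [sum_apply, comp_apply]
    refine Finset.sum_congr rfl fun j _ => ?_
    rw [pow_succ (adjoint V) j]
    simp [hVx]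
  obtain ⟨A, hA⟩ : ∃ A : ℕ → H →L[ℂ] K, ∀ n, A n =
    ((n : ℂ) + 1)⁻¹ • ∑ i ∈ Finset.range (n + 1), S i := ⟨_, fun _ => rfl⟩
  have hn0 : ∀ n : ℕ, ((n : ℂ) + 1) ≠ 0 := fun n => by exact_mod_cast n.succ_ne_zero
  have hnn : ∀ n : ℕ, ‖((n : ℂ) + 1)‖ = (n : ℝ) + 1 := fun n => by
    have := Complex.norm_natCast (n + 1)
    push_cast at this
    exact this
  have hAb : ∀ n, ‖A n‖ ≤ M := fun n => by
    rw [hA, norm_smul, norm_inv, hnn, inv_mul_le_iff₀ (by positivity)]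
    refine (norm_sum_le_of_le _ (fun i _ => hM i)).trans ?_
    simp
  have hAV : ∀ n h, A n (V (adjoint V h)) = A n h := fun n h => by
    simp [hA, hSV]
  have hsum : ∀ n h, ∑ i ∈ Finset.range (n + 1), S i (V h) =
      ((n : ℂ) + 1) • X h + T (∑ i ∈ Finset.range (n + 1), S i h) - T (S n h) := fun n h => by
    induction n with
    | zero => simp [hS0]
    | succ n ih =>
      rw [Finset.sum_range_succ, ih, hS1, Finset.sum_range_succ _ (n + 1), map_add]
      push_cast
      module
  have hAX : ∀ n h, A n (V h) = X h + T (A n h) - ((n : ℂ) + 1)⁻¹ • T (S n h) := fun n h => by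
    simp only [hA, smul_apply, sum_apply, hsum, smul_sub, smul_add, map_smul,
      inv_smul_smul₀ (hn0 n)]
  let U : Ultrafilter ℕ := Filter.hyperfilter ℕ
  have hU : (U : Filter ℕ) ≤ Filter.atTop := by
    rw [← Nat.cofinite_eq_atTop]; exact Filter.hyperfilter_le_cofinite
  obtain ⟨Z, hZ⟩ := aux_op U A M hAb
  have herr : ∀ h, Filter.Tendsto (fun n : ℕ => ((n : ℂ) + 1)⁻¹ • T (S n h)) U (nhds 0) := by
    intro h
    refine Filter.Tendsto.mono_left ?_ hU
    have h0 := (tendsto_one_div_add_atTop_nhds_zero_nat (𝕜 := ℝ)).mul_const (‖T‖ * (M * ‖h‖))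
    rw [zero_mul] at h0
    refine squeeze_zero_norm (fun n => ?_) h0
    rw [norm_smul, norm_inv, hnn, one_div]
    gcongr
    exact T.le_opNorm_of_le ((S n).le_of_opNorm_le (hM n) h)
  have hZV : ∀ h, Z (V h) = X h + T (Z h) := fun h => by
    refine ext_inner_right ℂ fun k => tendsto_nhds_unique (hZ (V h) k) ?_
    have h1 := ((hZ h (adjoint T k)).const_add (inner ℂ (X h) k)).sub
      ((herr h).inner (tendsto_const_nhds (x := k)) (𝕜 := ℂ))
    simpa only [hAX, adjoint_inner_right, inner_sub_left, inner_add_left, inner_zero_left,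
      sub_zero] using h1
  have hZVV : ∀ h, Z (V (adjoint V h)) = Z h := fun h => by
    refine ext_inner_right ℂ fun k => tendsto_nhds_unique (hZ _ k) ?_
    simpa only [hAV] using hZ h k
  refine ⟨-Z, ?_, ?_⟩
  · ext h
    simp [hZV]
  · ext h
    simp [hZVV]
end

section
/- Let C be a bounded operator on a Hilbert space H that is similar to a contraction, and let E be a bounded operator with spectral radius r(E) < 1 such that EC = 0. Then T = C + E is similar to a contraction. -/
open ContinuousLinearMap

/-- An operator is similar to a contraction if some conjugate of it by a bounded invertible
operator has norm at most `1`. -/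
def SimilarToContraction {E : Type*} [NormedAddCommGroup E] [NormedSpace ℂ E]
    (S : E →L[ℂ] E) : Prop :=
  ∃ L : E ≃L[ℂ] E, ‖(L.symm : E →L[ℂ] E) ∘L S ∘L (L : E →L[ℂ] E)‖ ≤ 1

/-- If `1 ≤ Q` and `T* Q T ≤ Q` as forms, then `T` is similar to a contraction. -/
theorem similar_of_form {H : Type*} [NormedAddCommGroup H] [InnerProductSpace ℂ H]
    [CompleteSpace H] (T Q : H →L[ℂ] H) (hQ : 1 ≤ Q)
    (h : ∀ x, (inner ℂ (Q (T x)) (T x)).re ≤ (inner ℂ (Q x) x).re) :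
    SimilarToContraction T := by
  have hQ0 : 0 ≤ Q := zero_le_one.trans hQ
  have hu : IsUnit Q := CStarAlgebra.isUnit_of_le 1 hQ
  have hR : IsUnit (CFC.sqrt Q) := (CFC.isUnit_sqrt_iff Q hQ0).2 hu
  have hRR : CFC.sqrt Q * CFC.sqrt Q = Q := CFC.sqrt_mul_sqrt_self Q hQ0
  have hsa : IsSelfAdjoint (CFC.sqrt Q) := (CFC.sqrt_nonneg Q).isSelfAdjoint
  have hn : ∀ x, (inner ℂ (Q x) x).re = ‖CFC.sqrt Q x‖ ^ 2 := by
    intro x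
    have h1 : inner ℂ (Q x) x = inner ℂ (CFC.sqrt Q x) (CFC.sqrt Q x) := by
      conv_lhs => rw [← hRR]
      rw [mul_apply_eq_comp]
      rw [← ContinuousLinearMap.adjoint_inner_right, hsa.adjoint_eq]
    rw [h1, ← inner_self_eq_norm_sq (𝕜 := ℂ)]
    rfl
  obtain ⟨u, hu'⟩ := hR
  refine ⟨(ContinuousLinearEquiv.ofUnit u).symm, ?_⟩
  refine ContinuousLinearMap.opNorm_le_bound _ zero_le_one fun k => ?_
  set x : H := (ContinuousLinearEquiv.ofUnit u).symm k with hx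
  have hk : CFC.sqrt Q x = k := by
    rw [← hu']
    exact (ContinuousLinearEquiv.ofUnit u).apply_symm_apply k
  have h2 := h x
  rw [hn, hn, hk] at h2
  have h3 : ‖CFC.sqrt Q (T x)‖ ≤ ‖k‖ := by
    exact le_of_sq_le_sq h2 (norm_nonneg _)
  rw [one_mul]
  rw [← hu'] at h3
  exact h3

theorem similar_aux {H : Type*} [NormedAddCommGroup H] [InnerProductSpace ℂ H]
    [CompleteSpace H] (C E : H →L[ℂ] H) (hC : ‖C‖ ≤ 1) (hE : Summable fun n : ℕ => ‖E ^ n‖)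
    (hEC : E * C = 0) : SimilarToContraction (C + E) := by
  have hCs : ‖star C‖ ≤ 1 := by rwa [norm_star]
  have hCn : ∀ n : ℕ, ‖(star C) ^ n‖ ≤ 1 := by
    intro n
    induction n with
    | zero =>
      rw [pow_zero]
      exact ContinuousLinearMap.norm_id_le (𝕜 := ℂ) (E := H)
    | succ n ih =>
      rw [pow_succ]
      exact (norm_mul_le _ _).trans (mul_le_one₀ ih (norm_nonneg _) hCs)
  have hS : Summable fun n : ℕ => (star C) ^ n * E ^ n := by
    refine Summable.of_norm_bounded hE fun n => (norm_mul_le _ _).trans ?_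
    exact mul_le_of_le_one_left (norm_nonneg _) (hCn n)
  have hP : Summable fun n : ℕ => (star E) ^ n * E ^ n := by
    have hb : ∃ K : ℝ, ∀ n, ‖E ^ n‖ ≤ K := by
      obtain ⟨K, hK⟩ := hE.tendsto_atTop_zero.bddAbove_range
      exact ⟨K, fun n => hK ⟨n, rfl⟩⟩
    obtain ⟨K, hK⟩ := hb
    refine Summable.of_norm_bounded (hE.mul_left K) fun n => (norm_mul_le _ _).trans ?_
    rw [← star_pow, norm_star]
    exact mul_le_mul_of_nonneg_right (hK n) (norm_nonneg _)
  have fix : ∀ B : H →L[ℂ] H, (Summable fun n : ℕ => B ^ n * E ^ n) →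
      (∑' n : ℕ, B ^ n * E ^ n) = 1 + B * (∑' n : ℕ, B ^ n * E ^ n) * E := by
    intro B hB
    conv_lhs => rw [hB.tsum_eq_zero_add]
    rw [← hB.tsum_mul_left, ← (hB.mul_left B).tsum_mul_right]
    have h0 : B ^ 0 * E ^ 0 = 1 := by rw [pow_zero, pow_zero, one_mul]
    have h1 : ∀ n : ℕ, B ^ (n + 1) * E ^ (n + 1) = B * (B ^ n * E ^ n) * E := by
      intro n
      rw [pow_succ', pow_succ]
      simp only [mul_assoc]
    rw [h0, tsum_congr h1]
  have hSf := fix _ hS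
  have hPf := fix _ hP
  have hP0 : 0 ≤ ∑' n : ℕ, (star E) ^ n * E ^ n := by
    refine tsum_nonneg fun n => ?_
    rw [← star_pow]
    exact star_mul_self_nonneg _
  generalize (∑' n : ℕ, (star C) ^ n * E ^ n) = S at hSf
  generalize (∑' n : ℕ, (star E) ^ n * E ^ n) = P at hPf hP0
  have adj : ∀ (B : H →L[ℂ] H) (x y : H), inner ℂ (star B x) y = inner ℂ x (B y) :=
    fun B x y => ContinuousLinearMap.adjoint_inner_left B y x
  have nsq : ∀ x : H, (inner ℂ x x).re = ‖x‖ ^ 2 := fun x =>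
    inner_self_eq_norm_sq (𝕜 := ℂ) x
  have hPpos := (ContinuousLinearMap.nonneg_iff_isPositive P).1 hP0
  have hf0 : ∀ x, 0 ≤ (inner ℂ (P x) x).re := fun x => hPpos.re_inner_nonneg_left x
  have hfE : ∀ x, (inner ℂ (P x) x).re = ‖x‖ ^ 2 + (inner ℂ (P (E x)) (E x)).re := by
    intro x
    have h1 : P x = x + star E (P (E x)) := by
      conv_lhs => rw [hPf]
      rfl
    conv_lhs => rw [h1]
    rw [inner_add_left, Complex.add_re, nsq, adj]
  have hEC' : ∀ x, E (C x) = 0 := fun x => by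
    have := congrArg (fun B : H →L[ℂ] H => B x) hEC
    simpa using this
  have hSx : ∀ x, S x = x + star C (S (E x)) := by
    intro x
    conv_lhs => rw [hSf]
    rfl
  set A : ℝ := ‖S‖ ^ 2 with hA
  set W : H →L[ℂ] H := 1 + star C * S * E with hW
  have hWx : ∀ x, W x = x + star C (S (E x)) := fun x => rfl
  set Q : H →L[ℂ] H := (2 : ℝ) • (star W * W) + (2 * A) • (star E * P * E) with hQ
  have hQx : ∀ x, (inner ℂ (Q x) x).re
      = 2 * ‖W x‖ ^ 2 + 2 * A * (inner ℂ (P (E x)) (E x)).re := by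
    intro x
    have h1 : Q x = ((2 : ℝ) : ℂ) • (star W (W x)) + ((2 * A : ℝ) : ℂ) • (star E (P (E x))) := rfl
    rw [h1, inner_add_left, inner_smul_left, inner_smul_left, adj, adj, Complex.conj_ofReal,
      Complex.conj_ofReal, Complex.add_re, Complex.re_ofReal_mul, Complex.re_ofReal_mul, nsq]
  have hSE : ∀ x, ‖S (E x)‖ ^ 2 ≤ A * ‖E x‖ ^ 2 := by
    intro x
    rw [hA, ← mul_pow]
    exact pow_le_pow_left₀ (norm_nonneg _) (S.le_opNorm _) 2
  have hA0 : 0 ≤ A := by positivity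
  refine similar_of_form _ Q ?_ ?_
  · have hsa : 0 ≤ Q := by
      refine add_nonneg (smul_nonneg (by norm_num) (star_mul_self_nonneg W))
        (smul_nonneg (by positivity) ?_)
      exact star_left_conjugate_nonneg hP0 E
    rw [← sub_nonneg, ContinuousLinearMap.nonneg_iff_isPositive,
      ContinuousLinearMap.isPositive_def']
    refine ⟨hsa.isSelfAdjoint.sub (IsSelfAdjoint.one _), fun x => ?_⟩
    change 0 ≤ (inner ℂ (Q x - x) x).re
    rw [inner_sub_left, Complex.sub_re, hQx, nsq]
    have h1 : ‖x‖ ≤ ‖W x‖ + ‖S (E x)‖ := by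
      have e : x = W x - star C (S (E x)) := by rw [hWx]; abel
      calc ‖x‖ = ‖W x - star C (S (E x))‖ := by rw [← e]
        _ ≤ ‖W x‖ + ‖star C (S (E x))‖ := norm_sub_le _ _
        _ ≤ _ := by
          gcongr
          exact (le_opNorm _ _).trans (mul_le_of_le_one_left (norm_nonneg _) hCs)
    have h2 : ‖x‖ ^ 2 ≤ 2 * ‖W x‖ ^ 2 + 2 * ‖S (E x)‖ ^ 2 := by
      have := pow_le_pow_left₀ (norm_nonneg _) h1 2
      nlinarith [sq_nonneg (‖W x‖ - ‖S (E x)‖)]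
    have h3 := hSE x
    have h4 : A * ‖E x‖ ^ 2 ≤ A * (inner ℂ (P (E x)) (E x)).re := by
      apply mul_le_mul_of_nonneg_left _ hA0
      rw [hfE (E x)]
      linarith [hf0 (E (E x))]
    linarith
  · intro x
    rw [hQx, hQx]
    have hET : E ((C + E) x) = E (E x) := by
      rw [ContinuousLinearMap.add_apply, map_add, hEC', zero_add]
    rw [hET]
    have hWT : W ((C + E) x) = C (W x - star C (S (E x))) + S (E x) := by
      rw [hWx, hET, hWx, add_sub_cancel_right, hSx (E x), ContinuousLinearMap.add_apply]
      abel
    have key : ∀ g s : H, ‖C (g - star C s) + s‖ ^ 2 ≤ ‖g‖ ^ 2 + ‖s‖ ^ 2 := by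
      intro g s
      have h1 : ‖C (g - star C s)‖ ^ 2 ≤ ‖g - star C s‖ ^ 2 :=
        pow_le_pow_left₀ (norm_nonneg _)
          ((le_opNorm _ _).trans (mul_le_of_le_one_left (norm_nonneg _) hC)) 2
      have h2 := norm_add_sq (𝕜 := ℂ) (C (g - star C s)) s
      have h3 := norm_add_sq (𝕜 := ℂ) (g - star C s) (star C s)
      have h4 : inner ℂ (C (g - star C s)) s = inner ℂ (g - star C s) (star C s) :=
        (ContinuousLinearMap.adjoint_inner_right C _ _).symm
      rw [h4] at h2
      rw [sub_add_cancel] at h3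
      nlinarith [sq_nonneg ‖star C s‖]
    have h1 := key (W x) (S (E x))
    rw [← hWT] at h1
    have h2 := hSE x
    have h3 := congrArg (fun t => A * t) (hfE (E x))
    simp only [mul_add] at h3
    linarith

theorem summable_pow_of_radius {A : Type*} [NormedRing A] [NormedAlgebra ℂ A] [CompleteSpace A]
    (a : A) (h : spectralRadius ℂ a < 1) : Summable fun n : ℕ => ‖a ^ n‖ := by
  obtain ⟨r, hr, hr1⟩ := exists_between h
  have h1 := spectrum.pow_nnnorm_pow_one_div_tendsto_nhds_spectralRadius a
  have h2 := h1.eventually_lt_const hr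
  lift r to NNReal using (hr1.trans ENNReal.one_lt_top).ne
  have hr1' : (r : ℝ) < 1 := by exact_mod_cast hr1
  refine Summable.of_norm_bounded_eventually_nat
    (summable_geometric_of_lt_one r.coe_nonneg hr1') ?_
  filter_upwards [h2, Filter.eventually_gt_atTop 0] with n hn hn0
  have hn0' : (0 : ℝ) < n := by exact_mod_cast hn0
  rw [one_div, ENNReal.rpow_inv_lt_iff hn0', ENNReal.rpow_natCast] at hn
  rw [norm_norm]
  have : ‖a ^ n‖₊ < r ^ n := by exact_mod_cast hn
  exact_mod_cast this.le

/-- a zero-product perturbation of an operator similar to a contraction by an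
operator of spectral radius smaller than `1` is similar to a contraction. -/
theorem stmt8 {H : Type*} [NormedAddCommGroup H] [InnerProductSpace ℂ H] [CompleteSpace H]
    (C E : H →L[ℂ] H) (hC : SimilarToContraction C)
    (hE : spectralRadius ℂ E < 1) (hEC : E ∘L C = 0) :
    SimilarToContraction (C + E) := by
  obtain ⟨L, hL⟩ := hC
  set l : H →L[ℂ] H := (L : H →L[ℂ] H) with hl
  set m : H →L[ℂ] H := (L.symm : H →L[ℂ] H) with hm
  have hlm : l * m = 1 := by ext x; exact L.apply_symm_apply x
  have hml : m * l = 1 := by ext x; exact L.symm_apply_apply x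
  have hpow : ∀ n : ℕ, (m * E * l) ^ n = m * E ^ n * l := by
    intro n
    induction n with
    | zero => simp [hml]
    | succ n ih =>
      rw [pow_succ, ih, pow_succ]
      calc m * E ^ n * l * (m * E * l) = m * E ^ n * (l * m) * E * l := by simp only [mul_assoc]
        _ = _ := by rw [hlm]; simp only [mul_assoc, one_mul]
  have hs : Summable fun n : ℕ => ‖(m * E * l) ^ n‖ := by
    refine Summable.of_nonneg_of_le (fun n => norm_nonneg _) (fun n => ?_)
      (((summable_pow_of_radius E hE).mul_left ‖m‖).mul_right ‖l‖)
    rw [hpow]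
    refine (norm_mul_le _ _).trans ?_
    gcongr
    exact norm_mul_le _ _
  have hz : (m * E * l) * (m * C * l) = 0 := by
    calc (m * E * l) * (m * C * l) = m * E * (l * m) * C * l := by simp only [mul_assoc]
      _ = m * (E * C) * l := by rw [hlm]; simp only [mul_assoc, one_mul]
      _ = 0 := by
        have : E * C = 0 := hEC
        rw [this]; simp
  obtain ⟨M, hM⟩ := similar_aux (m * C * l) (m * E * l) hL hs hz
  refine ⟨M.trans L, ?_⟩
  convert hM using 2
  ext x
  simp [hl, hm]
end
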